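/- arXiv:1502.01692 — 3 statements merged into one kernel-verified Lean document; each statement's English description precedes it below -/
import Mathlib

section
/- Let α, β : (0, ∞) → ℝ be positive functions and b : (0, ∞) → ℂ a function such that α(r)β(r) − |b(r)|² = 1 for all r > 0, and set H(r) = [[α(r), b(r)], [conj(b(r)), β(r)]]. If for every z ∈ ℂ with z ≠ 0 the commutator [φ(z), H(|z|)⁻¹φ(z)*H(|z|)] = 0, then b(r) = 0, α(r) = r^{1/2} and β(r) = r^{−1/2} for all r > 0. -/
open Matrix Complex

noncomputable def phi (z : ℂ) : Matrix (Fin 2) (Fin 2) ℂ := !![0, 1; z, 0]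

/-- The `H`-adjoint of a matrix `m`: `H⁻¹ mᴴ H`. -/
noncomputable def adjH (H m : Matrix (Fin 2) (Fin 2) ℂ) : Matrix (Fin 2) (Fin 2) ℂ :=
  H⁻¹ * mᴴ * H

/-- Matrix commutator. -/
noncomputable def mcomm {n : ℕ} (a b : Matrix (Fin n) (Fin n) ℂ) : Matrix (Fin n) (Fin n) ℂ :=
  a * b - b * a

/-- The `H`-adjoint of `phi z` for a hermitian `H` of determinant one. -/
theorem adjH_phi {a d : ℝ} {c : ℂ} (h : a * d - ‖c‖ ^ 2 = 1) (z : ℂ) :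
    adjH !![(a : ℂ), c; (starRingEnd ℂ) c, (d : ℂ)] (phi z) =
      !![d * starRingEnd ℂ z * starRingEnd ℂ c - c * a, starRingEnd ℂ z * d ^ 2 - c ^ 2;
        a ^ 2 - starRingEnd ℂ z * starRingEnd ℂ c ^ 2,
        a * c - starRingEnd ℂ c * starRingEnd ℂ z * d] := by
  have hc : (a : ℂ) * d - c * starRingEnd ℂ c = 1 := by
    rw [Complex.mul_conj']
    exact_mod_cast h
  have hinv : (!![(a : ℂ), c; (starRingEnd ℂ) c, (d : ℂ)])⁻¹ =
      !![(d : ℂ), -c; -(starRingEnd ℂ) c, (a : ℂ)] := by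
    apply Matrix.inv_eq_right_inv
    ext i j
    fin_cases i <;> fin_cases j <;> simp [Matrix.mul_apply, Fin.sum_univ_two] <;>
      first | ring1 | linear_combination hc
  have hstar : (phi z)ᴴ = !![0, starRingEnd ℂ z; 1, 0] := by
    ext i j
    fin_cases i <;> fin_cases j <;> simp [phi]
  rw [adjH, hinv, hstar]
  ext i j
  fin_cases i <;> fin_cases j <;> simp [Matrix.mul_apply, Fin.sum_univ_two] <;> ring

/-- A matrix commuting with `phi z` is of the form `x + y * phi z`. -/
theorem entries_of_mcomm_phi {z : ℂ} {m : Matrix (Fin 2) (Fin 2) ℂ} (h : mcomm (phi z) m = 0) :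
    m 1 0 = m 0 1 * z ∧ m 1 1 = m 0 0 := by
  have h₀ := congrFun (congrFun h 0) 0
  have h₁ := congrFun (congrFun h 0) 1
  simp only [mcomm, phi, Matrix.sub_apply, Matrix.mul_apply, Fin.sum_univ_two] at h₀ h₁
  simp at h₀ h₁
  exact ⟨sub_eq_zero.mp h₀, sub_eq_zero.mp h₁⟩

theorem stmt2 (α β : ℝ → ℝ) (b : ℝ → ℂ)
    (hα : ∀ r > (0 : ℝ), 0 < α r) (hβ : ∀ r > (0 : ℝ), 0 < β r)
    (hdet : ∀ r > (0 : ℝ), α r * β r - ‖b r‖ ^ 2 = 1)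
    (H : ℝ → Matrix (Fin 2) (Fin 2) ℂ)
    (hH : ∀ r, H r = !![(α r : ℂ), b r; (starRingEnd ℂ) (b r), (β r : ℂ)])
    (hcomm : ∀ z : ℂ, z ≠ 0 →
      mcomm (phi z) (adjH (H ‖z‖) (phi z)) = 0) :
    ∀ r > (0 : ℝ), b r = 0 ∧ α r = r ^ ((1 : ℝ) / 2) ∧ β r = r ^ (-(1 : ℝ) / 2) := by
  intro r hr
  have key : ∀ z : ℂ, z ≠ 0 → ‖z‖ = r →
      (α r : ℂ) ^ 2 - starRingEnd ℂ z * starRingEnd ℂ (b r) ^ 2 =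
        (starRingEnd ℂ z * β r ^ 2 - b r ^ 2) * z ∧
      α r * b r - starRingEnd ℂ (b r) * starRingEnd ℂ z * β r =
        β r * starRingEnd ℂ z * starRingEnd ℂ (b r) - b r * α r := by
    intro z hz hzr
    have h := hcomm z hz
    rw [hzr, hH, adjH_phi (hdet r hr)] at h
    simpa using entries_of_mcomm_phi h
  have hr₀ : (r : ℂ) ≠ 0 := by exact_mod_cast hr.ne'
  have hnorm : ‖(r : ℂ)‖ = r := by simp [abs_of_pos hr]
  obtain ⟨hdiag, hoff⟩ := key r hr₀ hnorm
  have hoff' := (key (-r) (neg_ne_zero.mpr hr₀) (by rw [norm_neg, hnorm])).2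
  simp only [map_neg, Complex.conj_ofReal] at hdiag hoff hoff'
  have hab : (α r : ℂ) * b r = 0 := by linear_combination (hoff + hoff') / 4
  have hα₀ : (α r : ℂ) ≠ 0 := by exact_mod_cast (hα r hr).ne'
  have hb : b r = 0 := (mul_eq_zero.mp hab).resolve_left hα₀
  have hαβ : α r * β r = 1 := by simpa [hb] using hdet r hr
  have hsq : α r ^ 2 = (r * β r) ^ 2 := by
    simp only [hb, map_zero] at hdiag
    have : (α r : ℂ) ^ 2 = (r * β r) ^ 2 := by linear_combination hdiag
    exact_mod_cast this
  have hαr : α r = r * β r :=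
    (pow_left_inj₀ (hα r hr).le (mul_pos hr (hβ r hr)).le two_ne_zero).mp hsq
  have hsqrt : α r = r ^ ((1 : ℝ) / 2) := by
    rw [← Real.sqrt_eq_rpow, eq_comm, Real.sqrt_eq_iff_mul_self_eq_of_pos (hα r hr)]
    linear_combination α r * hαr + r * hαβ
  refine ⟨hb, hsqrt, ?_⟩
  rw [neg_div, Real.rpow_neg hr.le, ← hsqrt]
  exact eq_inv_of_mul_eq_one_right hαβ
end

section
/- Let H_∞ be the matrix-valued function on ℂ \ {0} given by H_∞(z) = diag(|z|^{1/2}, |z|^{−1/2}). Then for every z ≠ 0: (i) [φ(z), H_∞(z)⁻¹φ(z)*H_∞(z)] = 0, and (ii) H_∞ is flat in the sense that ∂_z̄(H_∞⁻¹ ∂_z H_∞)(z) = 0, i.e. ∂_z̄(|z|^{−1/2}∂_z |z|^{1/2}) = 0 and ∂_z̄(|z|^{1/2}∂_z |z|^{−1/2}) = 0 at every z ≠ 0. Thus H_∞ solves the decoupled version of Hitchin's equation on ℂ \ {0}. -/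
open Matrix Complex

/-- Wirtinger derivative `∂_z f = (1/2)(∂f/∂x − i ∂f/∂y)` of `f : ℂ → ℂ`. -/
noncomputable def wd (f : ℂ → ℂ) (z : ℂ) : ℂ :=
  (1 / 2) * (fderiv ℝ f z 1 - Complex.I * fderiv ℝ f z Complex.I)

/-- Wirtinger derivative `∂_z̄ f = (1/2)(∂f/∂x + i ∂f/∂y)` of `f : ℂ → ℂ`. -/
noncomputable def wdbar (f : ℂ → ℂ) (z : ℂ) : ℂ :=
  (1 / 2) * (fderiv ℝ f z 1 + Complex.I * fderiv ℝ f z Complex.I)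

/-- Entrywise Wirtinger derivative `∂_z` of a matrix-valued function. -/
noncomputable def wdM (f : ℂ → Matrix (Fin 2) (Fin 2) ℂ) (z : ℂ) : Matrix (Fin 2) (Fin 2) ℂ :=
  Matrix.of fun i j => wd (fun w => f w i j) z

/-- Entrywise Wirtinger derivative `∂_z̄` of a matrix-valued function. -/
noncomputable def wdbarM (f : ℂ → Matrix (Fin 2) (Fin 2) ℂ) (z : ℂ) : Matrix (Fin 2) (Fin 2) ℂ :=
  Matrix.of fun i j => wdbar (fun w => f w i j) z

open Filter Topology

lemma wdbar_congr {f g : ℂ → ℂ} {z : ℂ} (h : f =ᶠ[𝓝 z] g) : wdbar f z = wdbar g z := by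
  simp only [wdbar, h.fderiv_eq]

lemma wd_zero (z : ℂ) : wd (fun _ => 0) z = 0 := by
  simp [wd]

lemma wdbar_zero (z : ℂ) : wdbar (fun _ => 0) z = 0 := by
  simp [wdbar]

lemma wdbar_eq_zero_of_differentiableAt {f : ℂ → ℂ} {z : ℂ} (h : DifferentiableAt ℂ f z) :
    wdbar f z = 0 := by
  have hI : fderiv ℂ f z I = I * fderiv ℂ f z 1 := by
    rw [← smul_eq_mul, ← map_smul, smul_eq_mul, mul_one]
  rw [wdbar, h.fderiv_restrictScalars ℝ]
  simp only [ContinuousLinearMap.coe_restrictScalars', hI]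
  linear_combination (1 / 2) * fderiv ℂ f z 1 * I_mul_I

lemma hasFDerivAt_norm_rpow_of_ne_zero (s : ℝ) {w : ℂ} (hw : w ≠ 0) :
    HasFDerivAt (fun v : ℂ => ‖v‖ ^ s) ((s * ‖w‖ ^ (s - 2)) • innerSL ℝ w) w := by
  have hsq (v : ℂ) (t : ℝ) : (‖v‖ ^ 2) ^ t = ‖v‖ ^ (2 * t) := by
    rw [← Real.rpow_natCast_mul (norm_nonneg v)]
    norm_num
  have h := (hasStrictFDerivAt_norm_sq w).hasFDerivAt.rpow_const (p := s / 2)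
    (Or.inl (pow_ne_zero 2 (norm_ne_zero_iff.mpr hw)))
  simp only [hsq, mul_sub, mul_one, mul_div_cancel₀ s (two_ne_zero' ℝ)] at h
  refine h.congr_fderiv ?_
  rw [← Nat.cast_smul_eq_nsmul ℝ, smul_smul]
  congr 1
  push_cast
  ring

lemma wd_norm_rpow (s : ℝ) {w : ℂ} (hw : w ≠ 0) :
    wd (fun v => ((‖v‖ ^ s : ℝ) : ℂ)) w = s / 2 * (‖w‖ ^ s : ℝ) * w⁻¹ := by
  have h := ofRealCLM.hasFDerivAt.comp w (hasFDerivAt_norm_rpow_of_ne_zero s hw)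
  have hf : fderiv ℝ (fun v : ℂ => ((‖v‖ ^ s : ℝ) : ℂ)) w = _ := h.fderiv
  have hr : ‖w‖ ≠ 0 := norm_ne_zero_iff.mpr hw
  have hconj : (w.re : ℂ) - I * w.im = (‖w‖ : ℂ) ^ 2 * w⁻¹ := by
    rw [← conj_mul', mul_assoc, mul_inv_cancel₀ hw]
    apply Complex.ext <;> simp
  have hpow : ‖w‖ ^ s = ‖w‖ ^ (s - 2) * ‖w‖ ^ 2 := by
    rw [← Real.rpow_add_natCast hr]
    norm_num
  rw [wd, hf, hpow]
  simp only [ContinuousLinearMap.comp_apply, _root_.smul_apply, innerSL_apply_apply,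
    Complex.inner, ofRealCLM_apply, smul_eq_mul, one_mul, conj_re, mul_re, I_re, I_im, zero_mul,
    conj_im, zero_sub, mul_neg, neg_neg, ofReal_mul, ofReal_pow]
  linear_combination (1 / 2) * (s : ℂ) * (‖w‖ ^ (s - 2) : ℝ) * hconj

lemma norm_rpow_mul_norm_rpow_of_add_eq_zero {s t : ℝ} (h : s + t = 0) {w : ℂ} (hw : w ≠ 0) :
    ((‖w‖ ^ s : ℝ) : ℂ) * ((‖w‖ ^ t : ℝ) : ℂ) = 1 := by
  rw [← ofReal_mul, ← Real.rpow_add (norm_pos_iff.mpr hw), h, Real.rpow_zero, ofReal_one]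

lemma wdbar_norm_rpow_mul_wd_norm_rpow {s t : ℝ} (h : s + t = 0) {z : ℂ} (hz : z ≠ 0) :
    wdbar (fun w => ((‖w‖ ^ s : ℝ) : ℂ) * wd (fun v => ((‖v‖ ^ t : ℝ) : ℂ)) w) z = 0 := by
  have heq : (fun w => ((‖w‖ ^ s : ℝ) : ℂ) * wd (fun v => ((‖v‖ ^ t : ℝ) : ℂ)) w)
      =ᶠ[𝓝 z] fun w => (t : ℂ) / 2 * w⁻¹ := by
    filter_upwards [isOpen_ne.mem_nhds hz] with w hw
    rw [wd_norm_rpow t hw]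
    linear_combination (t : ℂ) / 2 * w⁻¹ * norm_rpow_mul_norm_rpow_of_add_eq_zero h hw
  rw [wdbar_congr heq]
  exact wdbar_eq_zero_of_differentiableAt ((differentiableAt_inv hz).const_mul _)

lemma inv_diag_of_mul_eq_one {a b : ℂ} (h : a * b = 1) : (!![a, 0; 0, b])⁻¹ = !![b, 0; 0, a] := by
  apply Matrix.inv_eq_right_inv
  simp [h, mul_comm b a, Matrix.one_fin_two]

lemma mcomm_phi_adjH_diag {a b z : ℂ} (h : a * b = 1) (hz : a ^ 4 = z * star z) :
    mcomm (phi z) (adjH !![a, 0; 0, b] (phi z)) = 0 := by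
  have hb : z * star z * b ^ 2 = a ^ 2 := by
    rw [← hz]
    linear_combination a ^ 2 * (a * b + 1) * h
  rw [star_def] at hb
  have hphi : (phi z)ᴴ = !![0, starRingEnd ℂ z; 1, 0] := by
    ext i j
    fin_cases i <;> fin_cases j <;> simp [phi]
  rw [mcomm, adjH, inv_diag_of_mul_eq_one h, hphi, phi]
  ext i j
  fin_cases i <;> fin_cases j <;> simp
  · linear_combination -hb
  · linear_combination hb

theorem stmt3 (Hinf : ℂ → Matrix (Fin 2) (Fin 2) ℂ)
    (hHinf : ∀ z : ℂ, Hinf z =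
      !![((‖z‖ ^ ((1 : ℝ) / 2) : ℝ) : ℂ), 0;
         0, ((‖z‖ ^ (-(1 : ℝ) / 2) : ℝ) : ℂ)]) :
    ∀ z : ℂ, z ≠ 0 →
      mcomm (phi z) (adjH (Hinf z) (phi z)) = 0 ∧
      wdbarM (fun w => (Hinf w)⁻¹ * wdM Hinf w) z = 0 ∧
      wdbar (fun w => ((‖w‖ ^ (-(1 : ℝ) / 2) : ℝ) : ℂ) *
        wd (fun v => ((‖v‖ ^ ((1 : ℝ) / 2) : ℝ) : ℂ)) w) z = 0 ∧
      wdbar (fun w => ((‖w‖ ^ ((1 : ℝ) / 2) : ℝ) : ℂ) *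
        wd (fun v => ((‖v‖ ^ (-(1 : ℝ) / 2) : ℝ) : ℂ)) w) z = 0 := by
  intro z hz
  have hadd : (1 : ℝ) / 2 + -(1 : ℝ) / 2 = 0 := by norm_num
  have hadd' : -(1 : ℝ) / 2 + (1 : ℝ) / 2 = 0 := by norm_num
  have h₁ := wdbar_norm_rpow_mul_wd_norm_rpow hadd' hz
  have h₂ := wdbar_norm_rpow_mul_wd_norm_rpow hadd hz
  refine ⟨?_, ?_, h₁, h₂⟩
  · rw [hHinf]
    apply mcomm_phi_adjH_diag (norm_rpow_mul_norm_rpow_of_add_eq_zero hadd hz)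
    rw [star_def, mul_conj', ← ofReal_pow, ← ofReal_pow, ← Real.rpow_mul_natCast (norm_nonneg z),
      ← Real.rpow_natCast]
    norm_num
  · have hinv {w : ℂ} (hw : w ≠ 0) := inv_diag_of_mul_eq_one
      (norm_rpow_mul_norm_rpow_of_add_eq_zero hadd hw)
    have hH : (fun w => (Hinf w)⁻¹ * wdM Hinf w) =ᶠ[𝓝 z] fun w =>
        !![((‖w‖ ^ (-(1 : ℝ) / 2) : ℝ) : ℂ) * wd (fun v => ((‖v‖ ^ ((1 : ℝ) / 2) : ℝ) : ℂ)) w, 0;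
          0, ((‖w‖ ^ ((1 : ℝ) / 2) : ℝ) : ℂ) *
            wd (fun v => ((‖v‖ ^ (-(1 : ℝ) / 2) : ℝ) : ℂ)) w] := by
      filter_upwards [isOpen_ne.mem_nhds hz] with w hw
      rw [hHinf w, hinv hw, funext hHinf]
      ext i j
      fin_cases i <;> fin_cases j <;> simp [wdM, Matrix.mul_apply, Fin.sum_univ_two, wd_zero]
    ext i j
    have hij := wdbar_congr (hH.fun_comp fun m : Matrix (Fin 2) (Fin 2) ℂ => m i j)
    refine hij.trans ?_
    fin_cases i <;> fin_cases j
    · exact h₁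
    · exact wdbar_zero z
    · exact wdbar_zero z
    · exact h₂
end

section
/- Let k ≥ 1 be an integer, t > 0, and let h : (0, ∞) → ℝ be twice continuously differentiable. Define α : ℂ \ {0} → ℝ by α(z) = |z|^{k/2} e^{h(|z|)}. Then the equation ∂_z̄(α⁻¹ ∂_z α)(z) = t²(α(z)² − |z|^{2k} α(z)⁻²) holds for all z ≠ 0 if and only if h''(r) + h'(r)/r = 8 t² r^k sinh(2 h(r)) for all r > 0. -/
open Complex

theorem hasFDerivAt_norm_complex {z : ℂ} (hz : z ≠ 0) :
    HasFDerivAt (fun w : ℂ => ‖w‖) (‖z‖⁻¹ • innerSL ℝ z) z := by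
  have hn : ‖z‖ ≠ 0 := norm_ne_zero_iff.mpr hz
  have h1 := (hasStrictFDerivAt_norm_sq z).hasFDerivAt.sqrt (pow_ne_zero 2 hn)
  simp only [Real.sqrt_sq (norm_nonneg _)] at h1
  refine h1.congr_fderiv ?_
  ext
  all_goals
    simp
    field_simp

theorem hasFDerivAt_ofReal_comp_norm {φ : ℝ → ℝ} {φ' : ℝ} {z : ℂ} (hz : z ≠ 0)
    (hφ : HasDerivAt φ φ' ‖z‖) :
    HasFDerivAt (fun w : ℂ => ((φ ‖w‖ : ℝ) : ℂ))
      (ofRealCLM.comp (φ' • ‖z‖⁻¹ • innerSL ℝ z)) z :=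
  ofRealCLM.hasFDerivAt.comp z (hφ.comp_hasFDerivAt z (hasFDerivAt_norm_complex hz))

theorem wd_ofReal_comp_norm {φ : ℝ → ℝ} {φ' : ℝ} {z : ℂ} (hz : z ≠ 0)
    (hφ : HasDerivAt φ φ' ‖z‖) :
    wd (fun w : ℂ => ((φ ‖w‖ : ℝ) : ℂ)) z = (φ' / (2 * ‖z‖) : ℝ) * conjCLE z := by
  have hn : ‖z‖ ≠ 0 := norm_ne_zero_iff.mpr hz
  rw [wd, (hasFDerivAt_ofReal_comp_norm hz hφ).fderiv]
  apply Complex.ext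
  all_goals
    simp [Complex.inner, -ofReal_div, -ofReal_mul]
    field_simp

theorem wdbar_ofReal_comp_norm_mul_conj {φ : ℝ → ℝ} {φ' : ℝ} {z : ℂ} (hz : z ≠ 0)
    (hφ : HasDerivAt φ φ' ‖z‖) :
    wdbar (fun w : ℂ => ((φ ‖w‖ : ℝ) : ℂ) * conjCLE w) z =
      ((φ' * ‖z‖ / 2 + φ ‖z‖ : ℝ) : ℂ) := by
  have hn : ‖z‖ ≠ 0 := norm_ne_zero_iff.mpr hz
  have hsq : ‖z‖ ^ 2 = z.re * z.re + z.im * z.im := by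
    rw [Complex.sq_norm, Complex.normSq_apply]
  rw [wdbar, ((hasFDerivAt_ofReal_comp_norm hz hφ).fun_mul conjCLE.hasFDerivAt).fderiv]
  apply Complex.ext <;> simp [Complex.inner] <;> field_simp
  · linear_combination (-φ') * hsq
  · ring

theorem wdbar_inv_mul_wd_radial (k : ℕ) {h : ℝ → ℝ} (hh : ContDiffOn ℝ 2 h (Set.Ioi 0))
    {α : ℂ → ℝ} (hα : ∀ z : ℂ, α z = ‖z‖ ^ ((k : ℝ) / 2) * Real.exp (h ‖z‖))
    {z : ℂ} (hz : z ≠ 0) :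
    wdbar (fun w => ((α w : ℝ) : ℂ)⁻¹ * wd (fun v => ((α v : ℝ) : ℂ)) w) z =
      (((deriv (deriv h) ‖z‖ + deriv h ‖z‖ / ‖z‖) / 4 : ℝ) : ℂ) := by
  have hd1 : ∀ r > 0, HasDerivAt h (deriv h r) r := fun r hr =>
    ((hh.differentiableOn (by norm_num)).differentiableAt (Ioi_mem_nhds hr)).hasDerivAt
  have hd2 : ∀ r > 0, HasDerivAt (deriv h) (deriv (deriv h) r) r := fun r hr =>
    (((hh.deriv_of_isOpen (m := 1) isOpen_Ioi (by norm_num)).differentiableOn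
      (by norm_num)).differentiableAt (Ioi_mem_nhds hr)).hasDerivAt
  set G : ℝ → ℝ := fun r => (k / 2 / r + deriv h r) / (2 * r) with hG
  have hlog : ∀ w : ℂ, w ≠ 0 →
      ((α w : ℝ) : ℂ)⁻¹ * wd (fun v => ((α v : ℝ) : ℂ)) w = ((G ‖w‖ : ℝ) : ℂ) * conjCLE w := by
    intro w hw
    have hr : 0 < ‖w‖ := norm_pos_iff.mpr hw
    have hF := (Real.hasDerivAt_rpow_const (p := (k : ℝ) / 2) (Or.inl hr.ne')).mul
      (hd1 _ hr).exp
    have hfun : (fun v => ((α v : ℝ) : ℂ)) = fun v : ℂ =>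
        ((((fun r : ℝ => r ^ ((k : ℝ) / 2)) * fun r => Real.exp (h r)) ‖v‖ : ℝ) : ℂ) := by
      funext v
      simp [hα]
    rw [hfun, wd_ofReal_comp_norm hw hF, hα, ← mul_assoc, ← ofReal_inv, ← ofReal_mul]
    congr 2
    rw [Real.rpow_sub_one hr.ne', hG]
    have := (Real.rpow_pos_of_pos hr ((k : ℝ) / 2)).ne'
    have := (Real.exp_pos (h ‖w‖)).ne'
    field_simp
  have heq : (fun w => ((α w : ℝ) : ℂ)⁻¹ * wd (fun v => ((α v : ℝ) : ℂ)) w) =ᶠ[nhds z]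
      fun w => ((G ‖w‖ : ℝ) : ℂ) * conjCLE w := by
    filter_upwards [isOpen_ne.mem_nhds hz] with w hw using hlog w hw
  have hr : 0 < ‖z‖ := norm_pos_iff.mpr hz
  have hGd := (((hasDerivAt_const ‖z‖ ((k : ℝ) / 2)).div (hasDerivAt_id ‖z‖) hr.ne').add
    (hd2 _ hr)).div ((hasDerivAt_id ‖z‖).const_mul 2) (by simpa using hr.ne')
  have hmain := wdbar_ofReal_comp_norm_mul_conj (φ := G) hz hGd
  rw [wdbar, heq.fderiv_eq, ← wdbar, hmain, hG]
  congr 1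
  simp
  field_simp
  ring

theorem stmt7 (k : ℕ) (hk : 1 ≤ k) (t : ℝ) (ht : 0 < t)
    (h : ℝ → ℝ) (hh : ContDiffOn ℝ 2 h (Set.Ioi 0))
    (α : ℂ → ℝ)
    (hα : ∀ z : ℂ, α z = ‖z‖ ^ ((k : ℝ) / 2) * Real.exp (h ‖z‖)) :
    (∀ z : ℂ, z ≠ 0 →
        wdbar (fun w => ((α w : ℝ) : ℂ)⁻¹ * wd (fun v => ((α v : ℝ) : ℂ)) w) z =
          (t : ℂ) ^ 2 * (((α z : ℝ) : ℂ) ^ 2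
            - (‖z‖ : ℂ) ^ (2 * k) * (((α z : ℝ) : ℂ) ^ 2)⁻¹)) ↔
      (∀ r > (0 : ℝ), deriv (deriv h) r + deriv h r / r
        = 8 * t ^ 2 * r ^ k * Real.sinh (2 * h r)) := by
  have hrhs : ∀ z : ℂ, z ≠ 0 → (t : ℂ) ^ 2 * (((α z : ℝ) : ℂ) ^ 2
      - (‖z‖ : ℂ) ^ (2 * k) * (((α z : ℝ) : ℂ) ^ 2)⁻¹) =
      ((8 * t ^ 2 * ‖z‖ ^ k * Real.sinh (2 * h ‖z‖) / 4 : ℝ) : ℂ) := by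
    intro z hz
    have hr : 0 < ‖z‖ := norm_pos_iff.mpr hz
    have hsq : α z ^ 2 = ‖z‖ ^ k * Real.exp (2 * h ‖z‖) := by
      rw [hα, mul_pow, ← Real.rpow_mul_natCast hr.le, ← Real.exp_nat_mul]
      simp
    norm_cast
    rw [hsq, Real.sinh_eq, Real.exp_neg, pow_mul']
    have := (Real.exp_pos (2 * h ‖z‖)).ne'
    field_simp
    ring
  have hiff : ∀ z : ℂ, z ≠ 0 →
      (wdbar (fun w => ((α w : ℝ) : ℂ)⁻¹ * wd (fun v => ((α v : ℝ) : ℂ)) w) z =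
          (t : ℂ) ^ 2 * (((α z : ℝ) : ℂ) ^ 2
            - (‖z‖ : ℂ) ^ (2 * k) * (((α z : ℝ) : ℂ) ^ 2)⁻¹) ↔
        deriv (deriv h) ‖z‖ + deriv h ‖z‖ / ‖z‖
          = 8 * t ^ 2 * ‖z‖ ^ k * Real.sinh (2 * h ‖z‖)) := by
    intro z hz
    rw [wdbar_inv_mul_wd_radial k hh hα hz, hrhs z hz, ofReal_inj,
      div_left_inj' (by norm_num : (4 : ℝ) ≠ 0)]
  constructor
  · intro H r hr
    have hz : (r : ℂ) ≠ 0 := ofReal_ne_zero.mpr hr.ne'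
    simpa only [Complex.norm_of_nonneg hr.le] using (hiff r hz).mp (H r hz)
  · intro H z hz
    exact (hiff z hz).mpr (H _ (norm_pos_iff.mpr hz))
end
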